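/- arXiv:1004.1936 — 2 statements merged into one kernel-verified Lean document; each statement's English description precedes it below -/
import Mathlib

section
/- Let A ∈ M_n(ℂ) be non-singular and let d be a derivation of the evolution algebra E(A), with matrix entries d_{ij} defined by d(e_i) = ∑_{j=1}^n d_{ij} e_j. Then d_{ij} = 0 for all i ≠ j; that is, the matrix of d in the natural basis is diagonal. -/
open Matrix Polynomial Finset

/-- The multiplication of the evolution algebra `E(A)` on `ℂ^n` associated to the
matrix `A`: it is the unique commutative bilinear multiplication with
`e i · e j = 0` for `i ≠ j` and `e i · e i = ∑ k, A i k • e k`, where `e i = Pi.single i 1`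
is the standard (natural) basis. -/
noncomputable def evolMul {n : ℕ} (A : Matrix (Fin n) (Fin n) ℂ) (u v : Fin n → ℂ) : Fin n → ℂ :=
  fun k => ∑ i, u i * v i * A i k

/-- A linear map `d : E(A) → E(A)` is a derivation if `d (u·v) = d u · v + u · d v`. -/
def IsEvolDerivation {n : ℕ} (A : Matrix (Fin n) (Fin n) ℂ)
    (d : (Fin n → ℂ) →ₗ[ℂ] (Fin n → ℂ)) : Prop :=
  ∀ u v : Fin n → ℂ, d (evolMul A u v) = evolMul A (d u) v + evolMul A u (d v)

theorem evolMul_eq_vecMul {n : ℕ} (A : Matrix (Fin n) (Fin n) ℂ) (u v : Fin n → ℂ) :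
    evolMul A u v = (u * v) ᵥ* A :=
  rfl

/-- If `A` is non-singular, then every derivation of `E(A)` has diagonal matrix in the
natural basis: `dᵢⱼ = 0` for all `i ≠ j`. -/
theorem derivation_offdiag_eq_zero_of_det_ne_zero (n : ℕ) (hn : 1 ≤ n)
    (A : Matrix (Fin n) (Fin n) ℂ) (hA : A.det ≠ 0)
    (d : (Fin n → ℂ) →ₗ[ℂ] (Fin n → ℂ)) (hd : IsEvolDerivation A d) :
    ∀ i j : Fin n, i ≠ j → d (Pi.single i 1) j = 0 := by
  intro i j hij
  have horth : (Pi.single i 1 * Pi.single j 1 : Fin n → ℂ) = 0 := by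
    ext k
    by_cases hk : k = i
    · subst hk
      simp [hij]
    · simp [hk]
  have h := hd (Pi.single i 1) (Pi.single j 1)
  simp only [evolMul_eq_vecMul, horth, zero_vecMul, map_zero, ← add_vecMul] at h
  simpa [hij.symm] using congrFun (eq_zero_of_vecMul_eq_zero hA h.symm) j
end

section
/- Let A ∈ M_n(ℂ) be such that its first n−1 rows are linearly independent and e_n·e_n = b (e_1·e_1) for some b ∈ ℂ with b ≠ 0. Let d be a derivation of E(A) with matrix entries d_{ij}. Then d_{nn} = d_{11}, d_{jn} = d_{nj} = 0 for all 2 ≤ j ≤ n−1, d_{n1} = −b·d_{1n}, and d_{ij} = 0 for all 1 ≤ i ≠ j ≤ n−1. -/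
open Matrix Polynomial Finset

theorem evolMul_single_right {n : ℕ} (A : Matrix (Fin n) (Fin n) ℂ) (u : Fin n → ℂ) (j : Fin n) :
    evolMul A u (Pi.single j 1) = u j • A j := by
  ext k
  simp [evolMul, Pi.single_apply]

theorem evolMul_comm {n : ℕ} (A : Matrix (Fin n) (Fin n) ℂ) (u v : Fin n → ℂ) :
    evolMul A u v = evolMul A v u := by
  ext k
  simp [evolMul, mul_comm]

theorem IsEvolDerivation.smul_row_add_smul_row {n : ℕ} {A : Matrix (Fin n) (Fin n) ℂ}
    {d : (Fin n → ℂ) →ₗ[ℂ] (Fin n → ℂ)} (hd : IsEvolDerivation A d) {i j : Fin n} (hij : i ≠ j) :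
    d (Pi.single i 1) j • A j + d (Pi.single j 1) i • A i = 0 := by
  have h := hd (Pi.single i 1) (Pi.single j 1)
  rw [evolMul_single_right, evolMul_single_right, evolMul_comm A (Pi.single i 1),
    evolMul_single_right] at h
  simpa [Pi.single_apply, hij.symm] using h.symm

theorem IsEvolDerivation.map_row {n : ℕ} {A : Matrix (Fin n) (Fin n) ℂ}
    {d : (Fin n → ℂ) →ₗ[ℂ] (Fin n → ℂ)} (hd : IsEvolDerivation A d) (i : Fin n) :
    d (A i) = (2 * d (Pi.single i 1) i) • A i := by
  have h := hd (Pi.single i 1) (Pi.single i 1)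
  rw [evolMul_single_right, evolMul_single_right, evolMul_comm A (Pi.single i 1),
    evolMul_single_right] at h
  simpa [two_mul, add_smul] using h

/-- Suppose the first `n-1` rows of `A` are linearly independent and
`eₙ·eₙ = b (e₁·e₁)` with `b ≠ 0`.  Then any derivation `d` of `E(A)` satisfies
`dₙₙ = d₁₁`, `dⱼₙ = dₙⱼ = 0` for `2 ≤ j ≤ n-1`, `dₙ₁ = -b d₁ₙ`, and `dᵢⱼ = 0` for all
`i ≠ j` among `1,…,n-1`. -/
theorem derivation_entries_of_last_row_multiple_first (n : ℕ) (hn : 3 ≤ n)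
    (A : Matrix (Fin n) (Fin n) ℂ)
    (hrows : LinearIndependent ℂ (fun i : Fin (n - 1) => A (Fin.castLE (Nat.sub_le n 1) i)))
    (b : ℂ) (hb : b ≠ 0)
    (hlast : evolMul A (Pi.single (⟨n - 1, by omega⟩ : Fin n) 1)
        (Pi.single (⟨n - 1, by omega⟩ : Fin n) 1)
      = b • evolMul A (Pi.single (⟨0, by omega⟩ : Fin n) 1)
          (Pi.single (⟨0, by omega⟩ : Fin n) 1))
    (d : (Fin n → ℂ) →ₗ[ℂ] (Fin n → ℂ)) (hd : IsEvolDerivation A d) :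
    d (Pi.single (⟨n - 1, by omega⟩ : Fin n) 1) (⟨n - 1, by omega⟩ : Fin n)
        = d (Pi.single (⟨0, by omega⟩ : Fin n) 1) (⟨0, by omega⟩ : Fin n) ∧
      (∀ j : Fin n, 0 < j.val → j.val < n - 1 →
        d (Pi.single j 1) (⟨n - 1, by omega⟩ : Fin n) = 0 ∧
          d (Pi.single (⟨n - 1, by omega⟩ : Fin n) 1) j = 0) ∧
      d (Pi.single (⟨n - 1, by omega⟩ : Fin n) 1) (⟨0, by omega⟩ : Fin n)
        = -(b * d (Pi.single (⟨0, by omega⟩ : Fin n) 1) (⟨n - 1, by omega⟩ : Fin n)) ∧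
      (∀ i j : Fin n, i.val < n - 1 → j.val < n - 1 → i ≠ j →
        d (Pi.single i 1) j = 0) := by
  have row_ne (i : Fin n) (hi : i.val < n - 1) : A i ≠ 0 := hrows.ne_zero (⟨i.val, hi⟩ : Fin (n - 1))
  have coeff_zero (i j : Fin n) (hi : i.val < n - 1) (hj : j.val < n - 1) (hij : i ≠ j)
      (s t : ℂ) (h : s • A i + t • A j = 0) : s = 0 ∧ t = 0 := by
    have hne : (⟨i.val, hi⟩ : Fin (n - 1)) ≠ ⟨j.val, hj⟩ := by
      simpa [Fin.ext_iff] using hij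
    have hinj : Function.Injective ![(⟨i.val, hi⟩ : Fin (n - 1)), ⟨j.val, hj⟩] := by
      intro p q
      fin_cases p <;> fin_cases q <;> simp [hne, hne.symm]
    have hpair : LinearIndependent ℂ ![A i, A j] := by
      convert hrows.comp _ hinj using 1
      ext p
      fin_cases p <;> rfl
    exact LinearIndependent.pair_iff.mp hpair s t h
  generalize hl : (⟨n - 1, by omega⟩ : Fin n) = l at *
  generalize hz : (⟨0, by omega⟩ : Fin n) = z at *
  have hlv : l.val = n - 1 := by rw [← hl]
  have hzv : z.val = 0 := by rw [← hz]
  have hzlt : z.val < n - 1 := by omega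
  have hA : A l = b • A z := by simpa [evolMul_single_right] using hlast
  refine ⟨?_, ?_, ?_, ?_⟩
  · have h := hd.map_row l
    rw [hA, map_smul, hd.map_row z, smul_smul, smul_smul] at h
    have h' := smul_left_injective ℂ (row_ne z hzlt) h
    exact mul_left_cancel₀ (mul_ne_zero two_ne_zero hb) (by linear_combination -h')
  · intro j hj0 hj
    have hjl : j ≠ l := fun h => by rw [h] at hj; omega
    have hzj : z ≠ j := fun h => by rw [← h] at hj0; omega
    have h := hd.smul_row_add_smul_row hjl
    rw [hA, smul_smul] at h
    obtain ⟨h1, h2⟩ := coeff_zero z j hzlt hj hzj _ _ h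
    exact ⟨(mul_eq_zero.mp h1).resolve_right hb, h2⟩
  · have hzl : z ≠ l := fun h => by rw [h] at hzlt; omega
    have h := hd.smul_row_add_smul_row hzl
    rw [hA, smul_smul, ← add_smul] at h
    have h' := (smul_eq_zero.mp h).resolve_right (row_ne z hzlt)
    linear_combination h'
  · intro i j hi hj hij
    exact (coeff_zero j i hj hi hij.symm _ _ (hd.smul_row_add_smul_row hij)).1
end
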